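/- Let R be a commutative ring and I a proper ideal of R. Then R is projective as a module over the amalgamated duplication R⋈I (via the surjection ε : R⋈I → R, (r, r+i) ↦ r) if and only if I = Re for some idempotent element e of R. -/

import Mathlib

/-- The amalgamated duplication of a commutative ring `R` along an ideal `I`,
realized as the subring `{(x, y) ∈ R × R : y - x ∈ I}` of `R × R`. -/
def amalgDup (R : Type*) [CommRing R] (I : Ideal R) : Subring (R × R) where
  carrier := {p | p.2 - p.1 ∈ I}
  zero_mem' := by simp
  one_mem' := by simp
  add_mem' := by
    intro a b ha hb
    have := I.add_mem ha hb
    simpa [add_sub_add_comm] using this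
  neg_mem' := by
    intro a ha
    show -a.2 - -a.1 ∈ I
    have h : -a.2 - -a.1 = -(a.2 - a.1) := by ring
    rw [h]; exact I.neg_mem ha
  mul_mem' := by
    intro a b ha hb
    have : a.2 * b.2 - a.1 * b.1 = (a.2 - a.1) * b.2 + a.1 * (b.2 - b.1) := by ring
    show a.2 * b.2 - a.1 * b.1 ∈ I
    rw [this]
    exact I.add_mem (I.mul_mem_right _ ha) (I.mul_mem_left _ hb)

/-- A commutative ring is quasi-Frobenius if it is Noetherian and self-injective. -/
def IsQuasiFrobenius (R : Type*) [CommRing R] : Prop :=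
  IsNoetherianRing R ∧ Module.Injective R R

/-- The canonical surjection `ε : R⋈I → R`, `(r, r+i) ↦ r`. -/
def epsHom (R : Type*) [CommRing R] (I : Ideal R) : amalgDup R I →+* R :=
  (RingHom.fst R R).comp (amalgDup R I).subtype

/-- `R` as a module over `R⋈I` via the surjection `ε`. -/
instance epsModule (R : Type*) [CommRing R] (I : Ideal R) :
    Module (amalgDup R I) R :=
  Module.compHom R (epsHom R I)

/-- The canonical surjection `ε`, as a linear map over the amalgamated duplication. -/
def epsLinear (R : Type*) [CommRing R] (I : Ideal R) : amalgDup R I →ₗ[amalgDup R I] R where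
  toFun := epsHom R I
  map_add' := map_add _
  map_smul' a b := map_mul (epsHom R I) a b

theorem epsLinear_surjective (R : Type*) [CommRing R] (I : Ideal R) :
    Function.Surjective (epsLinear R I) := fun r =>
  ⟨⟨(r, r), show r - r ∈ I by simp⟩, rfl⟩

/-- The section `r ↦ (r, r(1 - e))` of `ε` when `I` is generated by the idempotent `e`. -/
def epsSection {R : Type*} [CommRing R] {I : Ideal R} {e : R} (he : e * e = e)
    (hI : I = Ideal.span {e}) : R →ₗ[amalgDup R I] amalgDup R I where
  toFun r := ⟨(r, r * (1 - e)), show r * (1 - e) - r ∈ I by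
    rw [hI, Ideal.mem_span_singleton]
    exact ⟨-r, by ring⟩⟩
  map_add' r s := Subtype.ext <| Prod.ext rfl (add_mul r s (1 - e))
  map_smul' a r := by
    obtain ⟨⟨x, y⟩, hxy : y - x ∈ I⟩ := a
    rw [hI, Ideal.mem_span_singleton] at hxy
    obtain ⟨c, hc⟩ := hxy
    refine Subtype.ext (Prod.ext rfl ?_)
    show x * r * (1 - e) = y * (r * (1 - e))
    linear_combination (-r * (1 - e)) * hc + r * c * he

/-- If `ε` has a linear section, then `I` is generated by an idempotent. -/
theorem exists_idempotent_of_section {R : Type*} [CommRing R] {I : Ideal R}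
    (s : R →ₗ[amalgDup R I] amalgDup R I) (hs : epsLinear R I ∘ₗ s = LinearMap.id) :
    ∃ e : R, e * e = e ∧ I = Ideal.span {e} := by
  have h1 : (s 1).1.1 = 1 := LinearMap.congr_fun hs 1
  have hmem : 1 - (s 1).1.2 ∈ I := by
    have h : (s 1).1.2 - (s 1).1.1 ∈ I := (s 1).2
    rw [h1] at h
    simpa using I.neg_mem h
  have hann : ∀ j ∈ I, j * (s 1).1.2 = 0 := fun j hj => by
    let a : amalgDup R I := ⟨(0, j), show j - 0 ∈ I by simpa using hj⟩
    have ha : a • (1 : R) = 0 := zero_mul (1 : R)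
    have h : a • s 1 = 0 := by rw [← map_smul, ha, map_zero]
    exact congrArg (fun b : amalgDup R I => b.1.2) h
  refine ⟨1 - (s 1).1.2, by linear_combination -hann _ hmem, le_antisymm (fun j hj => ?_) ?_⟩
  · rw [Ideal.mem_span_singleton]
    exact ⟨j, by linear_combination hann j hj⟩
  · rwa [Ideal.span_singleton_le_iff_mem]

theorem projective_amalgDup_iff_span_idempotent (R : Type*) [CommRing R]
    (I : Ideal R) (hI : I ≠ ⊤) :
    Module.Projective (amalgDup R I) R ↔
      ∃ e : R, e * e = e ∧ I = Ideal.span {e} := by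
  constructor
  · intro h
    obtain ⟨s, hs⟩ := Module.projective_lifting_property (epsLinear R I) LinearMap.id
      (epsLinear_surjective R I)
    exact exists_idempotent_of_section s hs
  · rintro ⟨e, he, hIe⟩
    exact Module.Projective.of_split (epsSection he hIe) (epsLinear R I)
      (LinearMap.ext fun _ => rfl)
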